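/- arXiv:2605.22397 — 3 statements merged into one kernel-verified Lean document; each statement's English description precedes it below -/
import Mathlib

section
/- For all integers s, t ≥ 2 there exists a constant δ(s,t) > 0 such that for every ε with 0 < ε < 1/3 and all sufficiently large n: ex_3^{bip}(⌊(1/3 + ε)n⌋, ⌊(1/3 + ε)n⌋, K_{t,s,s}) − ex_3^{bip}(⌊n/3⌋, ⌊n/3⌋, K_{t,s,s}) ≤ 10 · ε^{1/2} · δ(s,t) · n^{3−1/s²}. -/
open Finset

/-- `H` (a 3-graph given by its edge set on vertex type `V`) contains a copy of the
3-graph `F` (given by its edge set on vertex type `W`). -/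
def HasCopy {V W : Type*} [DecidableEq V] [DecidableEq W]
    (H : Finset (Finset V)) (F : Finset (Finset W)) : Prop :=
  ∃ f : W ↪ V, ∀ e ∈ F, e.image f ∈ H

/-- The Turán number `ex_3(n, F)`: the maximum number of hyperedges of an `F`-free
3-uniform hypergraph on `n` vertices. -/
noncomputable def exThree {W : Type*} [DecidableEq W] (n : ℕ) (F : Finset (Finset W)) : ℕ :=
  sSup {k | ∃ H : Finset (Finset (Fin n)), (∀ e ∈ H, e.card = 3) ∧ ¬ HasCopy H F ∧ H.card = k}

/-- The `i`-th part of the balanced tripartition of `Fin n` (vertices with residue `i` mod 3);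
the parts have sizes `⌊n/3⌋` or `⌈n/3⌉`. -/
def turanPart (n : ℕ) (i : Fin 3) : Finset (Fin n) :=
  Finset.univ.filter (fun v => (v : ℕ) % 3 = (i : ℕ))

/-- The balanced complete tripartite 3-graph `T_3(n,3)`: hyperedges are exactly the triples
with one vertex in each part of the balanced tripartition. -/
def T3 (n : ℕ) : Finset (Finset (Fin n)) :=
  Finset.univ.filter (fun e => e.card = 3 ∧ ∀ i : Fin 3, (e ∩ turanPart n i).card = 1)

/-- The 3-graph `F_5` on `{f_1, …, f_5}` with hyperedges `f_1f_2f_3, f_1f_2f_4, f_3f_4f_5`. -/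
def F5 : Finset (Finset (Fin 5)) := {{0,1,2},{0,1,3},{2,3,4}}

/-- `F_5(f_5;t)`: `F_5` with the vertex `f_5` blown up to `t` copies.
Here `inl 0, inl 1, inl 2, inl 3` play the roles of `f_1,f_2,f_3,f_4` and the
vertices `inr j` are the `t` copies of `f_5`. -/
def F5b5 (t : ℕ) : Finset (Finset (Fin 4 ⊕ Fin t)) :=
  ({({Sum.inl 0, Sum.inl 1, Sum.inl 2} : Finset (Fin 4 ⊕ Fin t)),
    ({Sum.inl 0, Sum.inl 1, Sum.inl 3} : Finset (Fin 4 ⊕ Fin t))} :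
      Finset (Finset (Fin 4 ⊕ Fin t))) ∪
  Finset.univ.image (fun j : Fin t => ({Sum.inl 2, Sum.inl 3, Sum.inr j} : Finset (Fin 4 ⊕ Fin t)))

/-- `F_5(f_3;t)`: `F_5` with the vertex `f_3` blown up to `t` copies.
Here `inl 0, inl 1, inl 2, inl 3` play the roles of `f_1,f_2,f_4,f_5` and the
vertices `inr j` are the `t` copies of `f_3`. -/
def F5b3 (t : ℕ) : Finset (Finset (Fin 4 ⊕ Fin t)) :=
  ({({Sum.inl 0, Sum.inl 1, Sum.inl 2} : Finset (Fin 4 ⊕ Fin t))} :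
      Finset (Finset (Fin 4 ⊕ Fin t))) ∪
  Finset.univ.image (fun j : Fin t => ({Sum.inl 0, Sum.inl 1, Sum.inr j} : Finset (Fin 4 ⊕ Fin t))) ∪
  Finset.univ.image (fun j : Fin t => ({Sum.inr j, Sum.inl 2, Sum.inl 3} : Finset (Fin 4 ⊕ Fin t)))

/-- `S^t(N)` (the size of `D(N,3,t,2)`): the maximum number of hyperedges of a 3-graph on `N`
vertices in which every pair of vertices is contained in at most `t-1` hyperedges. -/
noncomputable def Dmax (N t : ℕ) : ℕ :=
  sSup {k | ∃ H : Finset (Finset (Fin N)), (∀ e ∈ H, e.card = 3) ∧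
    (∀ u v : Fin N, u ≠ v → (H.filter (fun e => u ∈ e ∧ v ∈ e)).card ≤ t - 1) ∧ H.card = k}

/-- `e(T_3(n,3)^{t+})`: the number of hyperedges of `T_3(n,3)` together with a maximum
3-graph inside each part in which every pair of vertices lies in at most `t-1` hyperedges. -/
noncomputable def eT3plus (n t : ℕ) : ℕ :=
  (T3 n).card + ∑ i : Fin 3, Dmax ((turanPart n i).card) t

/-- `F` is a subgraph of a blow-up of `F_5`: every edge is a triple, and there is a map
to `V(F_5)` that is injective on each edge and sends each edge to an edge of `F_5`. -/
def IsSubBlowupF5 {W : Type*} [DecidableEq W] (F : Finset (Finset W)) : Prop :=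
  (∀ e ∈ F, e.card = 3) ∧ ∃ φ : W → Fin 5, ∀ e ∈ F, (e.image φ).card = 3 ∧ e.image φ ∈ F5

/-- The complete tripartite 3-graph with parts `A`, `B`, `C`: all triples with exactly
one vertex in each of `A`, `B`, `C`. -/
def tripartiteEdges {n : ℕ} (A B C : Finset (Fin n)) : Finset (Finset (Fin n)) :=
  Finset.univ.filter (fun e =>
    (e ∩ A).card = 1 ∧ (e ∩ B).card = 1 ∧ (e ∩ C).card = 1 ∧ e.card = 3)

/-- The complete 3-partite 3-graph `K_{t,s,s}` with parts of sizes `t`, `s`, `s`. -/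
def Ktss (t s : ℕ) : Finset (Finset (Fin t ⊕ Fin s ⊕ Fin s)) :=
  Finset.univ.image (fun x : Fin t × Fin s × Fin s =>
    ({Sum.inl x.1, Sum.inr (Sum.inl x.2.1), Sum.inr (Sum.inr x.2.2)} :
      Finset (Fin t ⊕ Fin s ⊕ Fin s)))

/-- All hyperedges of `H` consist of one vertex of the `A`-side (`Fin mA`) and two
vertices of the `B`-side (`Fin nB`). -/
def BipShape (mA nB : ℕ) (H : Finset (Finset (Fin mA ⊕ Fin nB))) : Prop :=
  ∀ e ∈ H, ∃ a : Fin mA, ∃ b c : Fin nB, b ≠ c ∧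
    e = ({Sum.inl a, Sum.inr b, Sum.inr c} : Finset (Fin mA ⊕ Fin nB))

/-- `H` contains a copy of `K_{t,s,s}` whose `t`-vertex part lies on the `A`-side and whose
two `s`-vertex parts lie on the `B`-side. -/
def HasBipKtss (mA nB t s : ℕ) (H : Finset (Finset (Fin mA ⊕ Fin nB))) : Prop :=
  ∃ (T : Finset (Fin mA)) (S0 S1 : Finset (Fin nB)), T.card = t ∧
    S0.card = s ∧ S1.card = s ∧ Disjoint S0 S1 ∧
    ∀ a ∈ T, ∀ b ∈ S0, ∀ c ∈ S1,
      ({Sum.inl a, Sum.inr b, Sum.inr c} : Finset (Fin mA ⊕ Fin nB)) ∈ H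

/-- The bipartite Turán number `ex_3^{bip}(mA, nB, K_{t,s,s})`. -/
noncomputable def exBip (mA nB t s : ℕ) : ℕ :=
  sSup {k | ∃ H : Finset (Finset (Fin mA ⊕ Fin nB)),
    BipShape mA nB H ∧ ¬ HasBipKtss mA nB t s H ∧ H.card = k}

/-- The `s`-set `S_0` inside the residue-0 part of `T_3(3m,3)`. -/
def S0set (m s : ℕ) (h : 2*s ≤ m) : Finset (Fin (3*m)) :=
  Finset.univ.image (fun i : Fin s => (⟨3*i.val, by have := i.isLt; omega⟩ : Fin (3*m)))

/-- The `s`-set `S_1` inside the residue-0 part of `T_3(3m,3)`, disjoint from `S_0`. -/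
def S1set (m s : ℕ) (h : 2*s ≤ m) : Finset (Fin (3*m)) :=
  Finset.univ.image (fun i : Fin s => (⟨3*(s+i.val), by have := i.isLt; omega⟩ : Fin (3*m)))

/-- The 3-graph `F_5^S(m,t,K_{s,s})`: `T_3(3m,3)` (on the `inl` vertices) together with a set
`T` of `t` new vertices (the `inr` vertices) and all triples consisting of one vertex of `T`,
one vertex of `S_0` and one vertex of `S_1`. -/
def F5Stss (m t s : ℕ) (h : 2*s ≤ m) : Finset (Finset (Fin (3*m) ⊕ Fin t)) :=
  (T3 (3*m)).image (fun e => e.image Sum.inl) ∪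
  Finset.univ.biUnion (fun j : Fin t =>
    ((S0set m s h) ×ˢ (S1set m s h)).image (fun p =>
      ({Sum.inr j, Sum.inl p.1, Sum.inl p.2} : Finset (Fin (3*m) ⊕ Fin t))))

/-- `F_sim(t)`: the 3-graph with hyperedges `f_1f_2f_3, f_1f_2f_4, f_3f_4f_5, f_5f_6f_7,
f_6f_7f_8` in which `f_8` is blown up to `t` copies. Here `inl 0, …, inl 6` play the roles
of `f_1, …, f_7` and the vertices `inr j` are the `t` copies of `f_8`. -/
def Fsim (t : ℕ) : Finset (Finset (Fin 7 ⊕ Fin t)) :=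
  ({({Sum.inl 0, Sum.inl 1, Sum.inl 2} : Finset (Fin 7 ⊕ Fin t)),
    ({Sum.inl 0, Sum.inl 1, Sum.inl 3} : Finset (Fin 7 ⊕ Fin t)),
    ({Sum.inl 2, Sum.inl 3, Sum.inl 4} : Finset (Fin 7 ⊕ Fin t)),
    ({Sum.inl 4, Sum.inl 5, Sum.inl 6} : Finset (Fin 7 ⊕ Fin t))} :
      Finset (Finset (Fin 7 ⊕ Fin t))) ∪
  Finset.univ.image (fun j : Fin t => ({Sum.inl 5, Sum.inl 6, Sum.inr j} : Finset (Fin 7 ⊕ Fin t)))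

/-- The 3-graph with parts `A`, `B`, `C` and an extra clique `X`: its hyperedges are the
triples with one vertex in each of `A`, `B`, `C`, all 3-subsets of `X`, and the triples with
one vertex in `X` and two vertices in a common part among `A`, `B`, `C`. -/
def simConstr (n : ℕ) (A B C X : Finset (Fin n)) : Finset (Finset (Fin n)) :=
  Finset.univ.filter (fun e => e.card = 3 ∧
    (((e ∩ A).card = 1 ∧ (e ∩ B).card = 1 ∧ (e ∩ C).card = 1) ∨
     e ⊆ X ∨
     ((e ∩ X).card = 1 ∧ ((e ∩ A).card = 2 ∨ (e ∩ B).card = 2 ∨ (e ∩ C).card = 2))))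

/-- `F_5^S(m)`: `T_3(3m,3)` together with one new vertex `v = inr ()` and one hyperedge
consisting of `v` and two vertices (`0` and `3`) lying in one part of `T_3(3m,3)`. -/
def F5Sm (m : ℕ) (hm : 2 ≤ m) : Finset (Finset (Fin (3*m) ⊕ Unit)) :=
  (T3 (3*m)).image (fun e => e.image Sum.inl) ∪
  {({Sum.inr (), Sum.inl ⟨0, by omega⟩, Sum.inl ⟨3, by omega⟩} : Finset (Fin (3*m) ⊕ Unit))}

/-- The disjoint union of `k` vertex-disjoint copies of the 3-graph `F`. -/
def copies (k : ℕ) {W : Type*} [DecidableEq W] (F : Finset (Finset W)) :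
    Finset (Finset (Fin k × W)) :=
  Finset.univ.biUnion (fun j : Fin k => F.image (fun e => e.image (fun w => (j, w))))

/-- The 3-graph `G(t,m,n)` (it does not depend on `m`): the vertices `v < t` form the set
`T`, the remaining `n - t` vertices carry a copy of `T_3(n-t,3)` (parts by residue of
`v - t` mod 3), and the hyperedges are those of this `T_3(n-t,3)` together with all
3-sets of vertices intersecting `T`. -/
def Gtmn (t n : ℕ) : Finset (Finset (Fin n)) :=
  Finset.univ.filter (fun e => e.card = 3 ∧
    ((∃ v ∈ e, (v : ℕ) < t) ∨
     (∀ i : Fin 3, (e.filter (fun v : Fin n => t ≤ (v : ℕ) ∧ ((v : ℕ) - t) % 3 = (i : ℕ))).card = 1)))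

/-- The blow-up of `F_5` in which every vertex is replaced by `t` copies:
the vertex `(i, j)` is the `j`-th copy of `f_{i+1}`. -/
def F5blowAll (t : ℕ) : Finset (Finset (Fin 5 × Fin t)) :=
  Finset.univ.biUnion (fun x : Fin t × Fin t × Fin t =>
    ({ ({((0:Fin 5), x.1), ((1:Fin 5), x.2.1), ((2:Fin 5), x.2.2)} : Finset (Fin 5 × Fin t)),
       ({((0:Fin 5), x.1), ((1:Fin 5), x.2.1), ((3:Fin 5), x.2.2)} : Finset (Fin 5 × Fin t)),
       ({((2:Fin 5), x.1), ((3:Fin 5), x.2.1), ((4:Fin 5), x.2.2)} : Finset (Fin 5 × Fin t)) } :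
      Finset (Finset (Fin 5 × Fin t))))

/-- Counting homomorphic images of `K_{s,s}`: a bipartite relation with `e` related pairs has at
least `e ^ (s * s) / |β| ^ (2 * s * (s - 1))` pairs of `s`-tuples that are completely related. -/
theorem pow_card_le_card_complete_tuples {β : Type*} [Fintype β] [DecidableEq β]
    (G : β → β → Prop) [DecidableRel G] (s : ℕ) (hs : 1 ≤ s) :
    #{p : β × β | G p.1 p.2} ^ (s * s) ≤ Fintype.card β ^ (2 * s * (s - 1)) *
      #{q : (Fin s → β) × (Fin s → β) | ∀ i j, G (q.1 i) (q.2 j)} := by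
  obtain ⟨k, rfl⟩ := Nat.exists_eq_add_of_le' hs
  set D : ℕ := #{q : β × (Fin (k + 1) → β) | ∀ j, G q.1 (q.2 j)} with hD
  have edges : #{p : β × β | G p.1 p.2} = ∑ b : β, #{c | G b c} := by
    simp only [card_filter, ← univ_product_univ, sum_product]
  have stars : D = ∑ b : β, #{c | G b c} ^ (k + 1) := by
    rw [hD, card_filter, ← univ_product_univ, sum_product]
    refine sum_congr rfl fun b _ => ?_
    rw [← card_filter]
    have : ({y : Fin (k + 1) → β | ∀ j, G b (y j)} : Finset _)
        = Fintype.piFinset (fun _ => ({c | G b c} : Finset β)) := by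
      ext y; simp
    rw [this]; simp
  have stars' : D = ∑ y : Fin (k + 1) → β, #{b | ∀ j, G b (y j)} := by
    rw [hD, card_filter, ← univ_product_univ, sum_product_right]
    simp only [card_filter]
  have tuples : #{q : (Fin (k + 1) → β) × (Fin (k + 1) → β) | ∀ i j, G (q.1 i) (q.2 j)}
      = ∑ y : Fin (k + 1) → β, #{b | ∀ j, G b (y j)} ^ (k + 1) := by
    rw [card_filter, ← univ_product_univ, sum_product_right]
    refine sum_congr rfl fun y _ => ?_
    rw [← card_filter]
    have : ({x : Fin (k + 1) → β | ∀ i j, G (x i) (y j)} : Finset _)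
        = Fintype.piFinset (fun _ => ({b | ∀ j, G b (y j)} : Finset β)) := by
      ext x; simp
    rw [this]; simp
  have h1 := pow_sum_le_card_mul_sum_pow (s := (univ : Finset β))
    (f := fun b => #{c | G b c}) (fun _ _ => Nat.zero_le _) k
  have h2 := pow_sum_le_card_mul_sum_pow (s := (univ : Finset (Fin (k + 1) → β)))
    (f := fun y => #{b | ∀ j, G b (y j)}) (fun _ _ => Nat.zero_le _) k
  rw [← edges, ← stars] at h1
  rw [← stars', ← tuples] at h2
  simp only [card_univ, Fintype.card_pi, prod_const, Fintype.card_fin, Nat.cast_id] at h1 h2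
  calc _ = (#{p : β × β | G p.1 p.2} ^ (k + 1)) ^ (k + 1) := by rw [pow_mul]
    _ ≤ (Fintype.card β ^ k * D) ^ (k + 1) := by gcongr
    _ = Fintype.card β ^ (k * (k + 1)) * D ^ (k + 1) := by rw [mul_pow, ← pow_mul]
    _ ≤ _ := by
      refine (Nat.mul_le_mul_left _ h2).trans (le_of_eq ?_)
      rw [← mul_assoc, ← pow_mul, ← pow_add, Nat.add_sub_cancel]
      congr 2
      ring

/-- Few tuples fail to be injective. -/
theorem card_not_injective_mul_le {β : Type*} [Fintype β] [DecidableEq β] (s : ℕ) :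
    #{x : Fin s → β | ¬ Function.Injective x} * Fintype.card β ≤ s * s * Fintype.card β ^ s := by
  have pair : ∀ i j : Fin s, i ≠ j →
      #{x : Fin s → β | x i = x j} * Fintype.card β ≤ Fintype.card β ^ s := by
    intro i j hij
    have h : #(({x | x i = x j} : Finset (Fin s → β)) ×ˢ (univ : Finset β))
        ≤ #(univ : Finset (Fin s → β)) := by
      refine card_le_card_of_injOn (fun p => Function.update p.1 i p.2) (by simp) ?_
      rintro ⟨x, v⟩ hx ⟨y, w⟩ hy h
      simp only [coe_product, Set.mem_prod, mem_coe, mem_filter, mem_univ, true_and,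
        and_true] at hx hy
      have hk := fun k => congrFun h k
      have hv : v = w := by simpa using hk i
      have off : ∀ k, k ≠ i → x k = y k := fun k hki => by simpa [hki] using hk k
      refine Prod.ext (funext fun k => ?_) hv
      by_cases hki : k = i
      · subst hki
        simp only
        rw [hx, hy, off j hij.symm]
      · exact off k hki
    simpa [card_product] using h
  have cover : ({x : Fin s → β | ¬ Function.Injective x} : Finset _) ⊆
      ({p : Fin s × Fin s | p.1 ≠ p.2} : Finset _).biUnion
        (fun p => ({x | x p.1 = x p.2} : Finset (Fin s → β))) := by
    intro x hx
    simp only [mem_filter, mem_univ, true_and, Function.Injective, not_forall] at hx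
    obtain ⟨i, j, hx, hij⟩ := hx
    simp only [mem_biUnion, mem_filter, mem_univ, true_and]
    exact ⟨(i, j), hij, hx⟩
  calc _ ≤ (∑ p : Fin s × Fin s with p.1 ≠ p.2, #{x : Fin s → β | x p.1 = x p.2})
        * Fintype.card β := by gcongr; exact (card_le_card cover).trans card_biUnion_le
    _ = ∑ p : Fin s × Fin s with p.1 ≠ p.2,
        #{x : Fin s → β | x p.1 = x p.2} * Fintype.card β := sum_mul _ _ _
    _ ≤ ∑ p : Fin s × Fin s with p.1 ≠ p.2, Fintype.card β ^ s :=
        sum_le_sum fun p hp => pair _ _ (by simpa using hp)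
    _ ≤ _ := by
      rw [sum_const, smul_eq_mul]
      gcongr
      exact (card_filter_le _ _).trans (by simp)

/-- The set of ordered triples `(a, b, c)` of a 3-graph with one vertex in `A` and two in `B`:
symmetric in `b, c`, without loops, and without a `K_{t,s,s}`. -/
structure IsFreeTripleSet {N : ℕ} (t s : ℕ) (T : Finset (Fin N × Fin N × Fin N)) : Prop where
  symm : ∀ a b c, (a, b, c) ∈ T → (a, c, b) ∈ T
  irrefl : ∀ a b, (a, b, b) ∉ T
  free : ∀ (X : Finset (Fin N)) (S0 S1 : Finset (Fin N)), #X = t → #S0 = s → #S1 = s →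
    Disjoint S0 S1 → ¬ ∀ a ∈ X, ∀ b ∈ S0, ∀ c ∈ S1, (a, b, c) ∈ T

/-- The Kővári–Sós–Turán/Erdős upper bound for the number of ordered triples. -/
theorem IsFreeTripleSet.card_pow_le {N t s : ℕ} {T : Finset (Fin N × Fin N × Fin N)}
    (hT : IsFreeTripleSet t s T) (hs : 1 ≤ s) (ht : 1 ≤ t) :
    #T ^ (s * s) ≤ (t + 2 * (s * s)) * N ^ (3 * (s * s) - 1) := by
  set X : Fin N → ℕ := fun a =>
    #{q : (Fin s → Fin N) × (Fin s → Fin N) | ∀ i j, (a, q.1 i, q.2 j) ∈ T} with hX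
  have edges : #T = ∑ a, #{p : Fin N × Fin N | (a, p.1, p.2) ∈ T} := by
    simp only [card_filter]
    rw [← sum_product', univ_product_univ, ← card_filter]
    simp
  have hXa : ∀ a, #{p : Fin N × Fin N | (a, p.1, p.2) ∈ T} ^ (s * s)
      ≤ N ^ (2 * s * (s - 1)) * X a := fun a => by
    simpa using pow_card_le_card_complete_tuples (fun b c => (a, b, c) ∈ T) s hs
  have hinj : ∀ q : (Fin s → Fin N) × (Fin s → Fin N), Function.Injective q.1 →
      Function.Injective q.2 → #{a | ∀ i j, (a, q.1 i, q.2 j) ∈ T} ≤ t := by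
    intro q h1 h2
    by_contra! hlt
    obtain ⟨Y, hY, hYc⟩ := exists_subset_card_eq hlt.le
    have mem : ∀ a ∈ Y, ∀ i j, (a, q.1 i, q.2 j) ∈ T := fun a ha => by simpa using hY ha
    refine hT.free Y (univ.image q.1) (univ.image q.2) hYc (by simp [card_image_of_injective, h1])
      (by simp [card_image_of_injective, h2]) ?_ ?_
    · obtain ⟨a, ha⟩ : Y.Nonempty := card_pos.1 (by omega)
      rw [disjoint_left]
      simp only [mem_image, mem_univ, true_and, not_exists]
      rintro _ ⟨i, rfl⟩ j hj
      exact hT.irrefl a (q.1 i) (by simpa [hj] using mem a ha i j)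
    · simp only [mem_image, mem_univ, true_and]
      rintro a ha _ ⟨i, rfl⟩ _ ⟨j, rfl⟩
      exact mem a ha i j
  set Z := #{x : Fin s → Fin N | ¬ Function.Injective x} with hZ
  have hZle : Z * N ≤ s * s * N ^ s := by
    simpa using card_not_injective_mul_le (β := Fin N) s
  have total : ∑ a, X a ≤ (t + 2 * (s * s)) * N ^ (2 * s) := by
    have swap : ∑ a, X a = ∑ q : (Fin s → Fin N) × (Fin s → Fin N),
        #{a | ∀ i j, (a, q.1 i, q.2 j) ∈ T} := by
      simp only [hX, card_filter]
      exact sum_comm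
    have each : ∀ q : (Fin s → Fin N) × (Fin s → Fin N),
        #{a | ∀ i j, (a, q.1 i, q.2 j) ∈ T} ≤ t + ((if ¬ Function.Injective q.1 then N else 0)
          + (if ¬ Function.Injective q.2 then N else 0)) := by
      intro q
      have hN : #{a | ∀ i j, (a, q.1 i, q.2 j) ∈ T} ≤ N :=
        (card_filter_le _ _).trans (by simp)
      by_cases h1 : Function.Injective q.1
      · by_cases h2 : Function.Injective q.2
        · simpa [h1, h2] using hinj q h1 h2
        · simp only [h1, h2]; simp; omega
      · simp only [h1]; simp; omega
    have nfst : ∑ q : (Fin s → Fin N) × (Fin s → Fin N),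
        (if ¬ Function.Injective q.1 then N else 0) = N ^ s * (Z * N) := by
      rw [← univ_product_univ, sum_product_right, hZ]
      simp only [← sum_filter, sum_const, smul_eq_mul]
      simp
    have nsnd : ∑ q : (Fin s → Fin N) × (Fin s → Fin N),
        (if ¬ Function.Injective q.2 then N else 0) = N ^ s * (Z * N) := by
      rw [← univ_product_univ, sum_product, hZ]
      simp only [← sum_filter, sum_const, smul_eq_mul]
      simp
    rw [swap]
    refine (sum_le_sum fun q _ => each q).trans ?_
    rw [sum_add_distrib, sum_add_distrib, nfst, nsnd]
    simp only [sum_const, card_univ, Fintype.card_prod, Fintype.card_pi, prod_const,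
      Fintype.card_fin, smul_eq_mul]
    have := Nat.mul_le_mul_left (N ^ s) hZle
    calc _ ≤ N ^ s * N ^ s * t + (N ^ s * (s * s * N ^ s) + N ^ s * (s * s * N ^ s)) := by gcongr
      _ = _ := by ring
  have hss : 1 ≤ s * s := Nat.mul_pos hs hs
  have jensen := pow_sum_le_card_mul_sum_pow (s := (univ : Finset (Fin N)))
    (f := fun a => #{p : Fin N × Fin N | (a, p.1, p.2) ∈ T}) (fun _ _ => Nat.zero_le _) (s * s - 1)
  rw [← edges, Nat.sub_add_cancel hss] at jensen
  simp only [card_univ, Fintype.card_fin, Nat.cast_id] at jensen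
  calc _ ≤ N ^ (s * s - 1) * ∑ a, N ^ (2 * s * (s - 1)) * X a :=
        jensen.trans (Nat.mul_le_mul_left _ (sum_le_sum fun a _ => hXa a))
    _ ≤ N ^ (s * s - 1) * (N ^ (2 * s * (s - 1)) * ((t + 2 * (s * s)) * N ^ (2 * s))) := by
        rw [← mul_sum]; gcongr
    _ = (t + 2 * (s * s)) * (N ^ (s * s - 1) * N ^ (2 * s * (s - 1)) * N ^ (2 * s)) := by ring
    _ = _ := by
        rw [← pow_add, ← pow_add]
        congr 2
        obtain ⟨k, rfl⟩ := Nat.exists_eq_add_of_le' hs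
        simp only [Nat.add_sub_cancel]
        have : 1 ≤ (k + 1) * (k + 1) := hss
        zify [this, this.trans (Nat.le_mul_of_pos_left _ (by norm_num : 0 < 3))]
        ring

theorem IsFreeTripleSet.card_le {N t s : ℕ} {T : Finset (Fin N × Fin N × Fin N)}
    (hT : IsFreeTripleSet t s T) (hs : 1 ≤ s) (ht : 1 ≤ t) :
    (#T : ℝ) ≤ (t + 2 * (s * s) : ℝ) * (N : ℝ) ^ ((3 : ℝ) - 1 / (s : ℝ) ^ 2) := by
  have hss : 1 ≤ s * s := Nat.mul_pos hs hs
  have hK : (1 : ℝ) ≤ t + 2 * (s * s) := by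
    have : (1 : ℝ) ≤ t := by exact_mod_cast ht
    nlinarith [sq_nonneg (s : ℝ)]
  refine le_of_pow_le_pow_left₀ (n := s * s) (by omega) (by positivity) ?_
  rw [mul_pow, ← Real.rpow_mul_natCast (Nat.cast_nonneg N)]
  have hexp : ((3 : ℝ) - 1 / (s : ℝ) ^ 2) * ((s * s : ℕ) : ℝ) = ((3 * (s * s) - 1 : ℕ) : ℝ) := by
    have hs0 : (s : ℝ) ≠ 0 := by positivity
    rw [Nat.cast_sub (by omega)]
    push_cast
    field_simp
  rw [hexp, Real.rpow_natCast]
  calc (#T : ℝ) ^ (s * s) ≤ (t + 2 * (s * s) : ℝ) * (N : ℝ) ^ (3 * (s * s) - 1) := by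
        exact_mod_cast hT.card_pow_le hs ht
    _ ≤ _ := by
        gcongr
        exact le_self_pow₀ hK (by omega)

/-- Deleting a suitable pair of vertices, one from each side, loses at most a `3 / (N + 1)`
proportion of the ordered triples. -/
theorem IsFreeTripleSet.exists_delete {N t s : ℕ}
    {T : Finset (Fin (N + 1) × Fin (N + 1) × Fin (N + 1))} (hT : IsFreeTripleSet t s T) :
    ∃ T' : Finset (Fin N × Fin N × Fin N), IsFreeTripleSet t s T' ∧
      (N + 1) * #T ≤ (N + 1) * #T' + 3 * #T := by
  set d : Fin (N + 1) → ℕ := fun i =>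
    #{p ∈ T | p.1 = i} + #{p ∈ T | p.2.1 = i} + #{p ∈ T | p.2.2 = i} with hd
  have hsum : ∑ i, d i = 3 * #T := by
    simp only [hd, sum_add_distrib]
    rw [← card_eq_sum_card_fiberwise (fun p _ => mem_univ p.1),
      ← card_eq_sum_card_fiberwise (fun p _ => mem_univ p.2.1),
      ← card_eq_sum_card_fiberwise (fun p _ => mem_univ p.2.2)]
    ring
  obtain ⟨v, -, hv⟩ : ∃ v ∈ (univ : Finset (Fin (N + 1))), (N + 1) * d v ≤ 3 * #T := by
    refine exists_le_of_sum_le univ_nonempty ?_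
    rw [← mul_sum, hsum]
    simp
  let g : Fin N × Fin N × Fin N → Fin (N + 1) × Fin (N + 1) × Fin (N + 1) :=
    fun p => (v.succAbove p.1, v.succAbove p.2.1, v.succAbove p.2.2)
  refine ⟨univ.filter (fun p => g p ∈ T), ⟨?_, ?_, ?_⟩, ?_⟩
  · intro a b c h
    simp only [mem_filter, mem_univ, true_and, g] at h ⊢
    exact hT.symm _ _ _ h
  · intro a b h
    simp only [mem_filter, mem_univ, true_and, g] at h
    exact hT.irrefl _ _ h
  · intro X S0 S1 hX h0 h1 hdis h
    refine hT.free (X.map v.succAboveEmb) (S0.map v.succAboveEmb)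
      (S1.map v.succAboveEmb) (by simpa) (by simpa) (by simpa)
      ((disjoint_map _).2 hdis) ?_
    simp only [mem_map]
    rintro _ ⟨a, ha, rfl⟩ _ ⟨b, hb, rfl⟩ _ ⟨c, hc, rfl⟩
    simpa [g] using h a ha b hb c hc
  · have cover : T ⊆ (univ.filter (fun p => g p ∈ T)).image g ∪
        ({p ∈ T | p.1 = v} ∪ {p ∈ T | p.2.1 = v} ∪ {p ∈ T | p.2.2 = v}) := by
      rintro ⟨a, b, c⟩ h
      by_cases ha : a = v
      · exact mem_union_right _ (by subst ha; simp [h])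
      by_cases hb : b = v
      · exact mem_union_right _ (by subst hb; simp [h])
      by_cases hc : c = v
      · exact mem_union_right _ (by subst hc; simp [h])
      obtain ⟨a', rfl⟩ := Fin.exists_succAbove_eq ha
      obtain ⟨b', rfl⟩ := Fin.exists_succAbove_eq hb
      obtain ⟨c', rfl⟩ := Fin.exists_succAbove_eq hc
      exact mem_union_left _ (mem_image.2 ⟨(a', b', c'), by simpa [g] using h, rfl⟩)
    have hcard : #T ≤ #(univ.filter (fun p => g p ∈ T)) + d v := by
      refine (card_le_card cover).trans ((card_union_le _ _).trans ?_)
      refine Nat.add_le_add card_image_le ((card_union_le _ _).trans ?_)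
      exact Nat.add_le_add_right (card_union_le _ _) _
    calc _ ≤ (N + 1) * (#(univ.filter (fun p => g p ∈ T)) + d v) := Nat.mul_le_mul_left _ hcard
      _ ≤ _ := by rw [mul_add]; omega

theorem bddAbove_bip_card (m n t s : ℕ) : BddAbove {k | ∃ H : Finset (Finset (Fin m ⊕ Fin n)),
    BipShape m n H ∧ ¬ HasBipKtss m n t s H ∧ H.card = k} := by
  refine ⟨#(univ : Finset (Finset (Fin m ⊕ Fin n))), ?_⟩
  rintro k ⟨H, -, -, rfl⟩
  exact card_le_card (subset_univ _)

theorem triple_eq_iff {N : ℕ} (a a' b b' c c' : Fin N) (h : b ≠ c) :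
    (({Sum.inl a, Sum.inr b, Sum.inr c} : Finset (Fin N ⊕ Fin N)) =
      {Sum.inl a', Sum.inr b', Sum.inr c'}) ↔
      a = a' ∧ ((b = b' ∧ c = c') ∨ (b = c' ∧ c = b')) := by
  constructor
  · intro he
    have hl : a = a' := by
      have : Sum.inl a ∈ ({Sum.inl a', Sum.inr b', Sum.inr c'} : Finset (Fin N ⊕ Fin N)) := by
        rw [← he]; simp
      simpa using this
    have hr : ∀ x, x = b ∨ x = c ↔ x = b' ∨ x = c' := fun x => by
      have := congrArg (fun S => Sum.inr x ∈ S) he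
      simpa using this
    refine ⟨hl, ?_⟩
    have hb := (hr b).1 (Or.inl rfl)
    have hc := (hr c).1 (Or.inr rfl)
    have hb' := (hr b').2 (Or.inl rfl)
    have hc' := (hr c').2 (Or.inr rfl)
    grind
  · rintro ⟨rfl, ⟨rfl, rfl⟩ | ⟨rfl, rfl⟩⟩
    · rfl
    · ext x; simp; tauto

/-- A set of ordered triples yields a 3-graph with at least half as many hyperedges. -/
theorem IsFreeTripleSet.card_le_two_mul_exBip {N t s : ℕ} {T : Finset (Fin N × Fin N × Fin N)}
    (hT : IsFreeTripleSet t s T) : #T ≤ 2 * exBip N N t s := by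
  have ne_of_mem : ∀ {a b c}, (a, b, c) ∈ T → b ≠ c := by
    rintro a b c h rfl
    exact hT.irrefl _ _ h
  let f : Fin N × Fin N × Fin N → Finset (Fin N ⊕ Fin N) :=
    fun p => {Sum.inl p.1, Sum.inr p.2.1, Sum.inr p.2.2}
  have hmem : ∀ a b c, f (a, b, c) ∈ T.image f → (a, b, c) ∈ T := by
    intro a b c h
    obtain ⟨⟨a', b', c'⟩, h', he⟩ := mem_image.1 h
    obtain ⟨rfl, ⟨rfl, rfl⟩ | ⟨rfl, rfl⟩⟩ := (triple_eq_iff _ _ _ _ _ _ (ne_of_mem h')).1 he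
    · exact h'
    · exact hT.symm _ _ _ h'
  have hle : #(T.image f) ≤ exBip N N t s := by
    refine le_csSup (bddAbove_bip_card N N t s) ⟨T.image f, ?_, ?_, rfl⟩
    · intro e he
      obtain ⟨⟨a, b, c⟩, h, rfl⟩ := mem_image.1 he
      exact ⟨a, b, c, ne_of_mem h, rfl⟩
    · rintro ⟨X, S0, S1, hX, h0, h1, hdis, h⟩
      exact hT.free X S0 S1 hX h0 h1 hdis fun a ha b hb c hc => hmem a b c (h a ha b hb c hc)
  refine (card_le_mul_card_image T 2 (f := f) ?_).trans (Nat.mul_le_mul_left 2 hle)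
  intro e he
  obtain ⟨⟨a, b, c⟩, h, rfl⟩ := mem_image.1 he
  refine (card_le_card (t := {(a, b, c), (a, c, b)}) ?_).trans card_le_two
  rintro ⟨a', b', c'⟩ h'
  obtain ⟨-, h'⟩ := mem_filter.1 h'
  obtain ⟨rfl, ⟨rfl, rfl⟩ | ⟨rfl, rfl⟩⟩ :=
    (triple_eq_iff _ _ _ _ _ _ (ne_of_mem h)).1 h'.symm <;> simp

theorem exists_isFreeTripleSet (N t s : ℕ) (hs : 1 ≤ s) (ht : 1 ≤ t) :
    ∃ T : Finset (Fin N × Fin N × Fin N), IsFreeTripleSet t s T ∧ 2 * exBip N N t s ≤ #T := by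
  obtain ⟨H, hshape, hfree, hcard⟩ : exBip N N t s ∈
      {k | ∃ H : Finset (Finset (Fin N ⊕ Fin N)),
        BipShape N N H ∧ ¬ HasBipKtss N N t s H ∧ H.card = k} := by
    refine Nat.sSup_mem ⟨0, ∅, by simp [BipShape], ?_, rfl⟩ (bddAbove_bip_card N N t s)
    rintro ⟨X, S0, S1, hX, h0, h1, -, h⟩
    obtain ⟨a, ha⟩ : X.Nonempty := card_pos.1 (by omega)
    obtain ⟨b, hb⟩ : S0.Nonempty := card_pos.1 (by omega)
    obtain ⟨c, hc⟩ : S1.Nonempty := card_pos.1 (by omega)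
    simpa using h a ha b hb c hc
  let f : Fin N × Fin N × Fin N → Finset (Fin N ⊕ Fin N) :=
    fun p => {Sum.inl p.1, Sum.inr p.2.1, Sum.inr p.2.2}
  have fsymm : ∀ a b c, f (a, b, c) = f (a, c, b) := by
    intro a b c
    simp only [f]
    ext x; simp; tauto
  refine ⟨univ.filter (fun p => f p ∈ H), ⟨?_, ?_, ?_⟩, ?_⟩
  · intro a b c h
    simpa [fsymm a c b] using h
  · intro a b h
    obtain ⟨a', b', c', hne, he⟩ := hshape _ (by simpa using h : f (a, b, b) ∈ H)
    have := (triple_eq_iff _ _ _ _ _ _ hne).1 he.symm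
    grind
  · intro X S0 S1 hX h0 h1 hdis h
    exact hfree ⟨X, S0, S1, hX, h0, h1, hdis, fun a ha b hb c hc => by
      simpa [f] using h a ha b hb c hc⟩
  · rw [← hcard]
    have key : ∀ e ∈ H, ∃ a b c, b ≠ c ∧ e = f (a, b, c) := hshape
    refine mul_card_image_le_card_of_maps_to (f := f) (by simp) 2 ?_
    intro e he
    obtain ⟨a, b, c, hne, rfl⟩ := key e he
    rw [← card_pair (a := (a, b, c)) (b := (a, c, b)) (by simp [hne])]
    refine card_le_card ?_
    intro p hp
    simp only [mem_insert, mem_singleton] at hp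
    obtain rfl | rfl := hp
    · simpa using he
    · rw [fsymm a b c] at he
      simpa [fsymm a c b] using he

theorem exBip_succ_le (N t s : ℕ) (hs : 1 ≤ s) (ht : 1 ≤ t) :
    (exBip (N + 1) (N + 1) t s : ℝ) ≤ exBip N N t s +
      3 / 2 * (t + 2 * (s * s) : ℝ) * ((N + 1 : ℕ) : ℝ) ^ ((2 : ℝ) - 1 / (s : ℝ) ^ 2) := by
  obtain ⟨T, hT, hcard⟩ := exists_isFreeTripleSet (N + 1) t s hs ht
  obtain ⟨T', hT', hle⟩ := hT.exists_delete
  have h1 : (2 : ℝ) * exBip (N + 1) (N + 1) t s ≤ #T := by exact_mod_cast hcard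
  have h2 : (#T' : ℝ) ≤ 2 * exBip N N t s := by exact_mod_cast hT'.card_le_two_mul_exBip
  have h3 : ((N + 1 : ℕ) : ℝ) * #T ≤ ((N + 1 : ℕ) : ℝ) * #T' + 3 * #T := by exact_mod_cast hle
  have h4 := hT.card_le hs ht
  have hpos : (0 : ℝ) < ((N + 1 : ℕ) : ℝ) := by positivity
  have hexp : ((N + 1 : ℕ) : ℝ) ^ ((3 : ℝ) - 1 / (s : ℝ) ^ 2) =
      ((N + 1 : ℕ) : ℝ) * ((N + 1 : ℕ) : ℝ) ^ ((2 : ℝ) - 1 / (s : ℝ) ^ 2) := by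
    rw [← Real.rpow_one_add' hpos.le]
    · congr 1; ring
    · have : 1 / (s : ℝ) ^ 2 ≤ 1 := by
        rw [div_le_one (by positivity)]
        exact one_le_pow₀ (by exact_mod_cast hs)
      linarith
  rw [hexp] at h4
  have h5 : (#T : ℝ) ≤ #T' +
      3 * ((t + 2 * (s * s) : ℝ) * ((N + 1 : ℕ) : ℝ) ^ ((2 : ℝ) - 1 / (s : ℝ) ^ 2)) := by
    refine le_of_mul_le_mul_left ?_ hpos
    linarith
  linarith

theorem exBip_add_le (M k t s n : ℕ) (hs : 1 ≤ s) (ht : 1 ≤ t) (hn : M + k ≤ n) :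
    (exBip (M + k) (M + k) t s : ℝ) ≤ exBip M M t s +
      k * (3 / 2 * (t + 2 * (s * s) : ℝ) * (n : ℝ) ^ ((2 : ℝ) - 1 / (s : ℝ) ^ 2)) := by
  induction k with
  | zero => simp
  | succ k ih =>
    have hle := exBip_succ_le (M + k) t s hs ht
    have hmono : ((M + k + 1 : ℕ) : ℝ) ^ ((2 : ℝ) - 1 / (s : ℝ) ^ 2) ≤
        (n : ℝ) ^ ((2 : ℝ) - 1 / (s : ℝ) ^ 2) := by
      refine Real.rpow_le_rpow (by positivity) (by exact_mod_cast hn) ?_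
      have : 1 / (s : ℝ) ^ 2 ≤ 1 := by
        rw [div_le_one (by positivity)]
        exact one_le_pow₀ (by exact_mod_cast hs)
      linarith
    have hmul := mul_le_mul_of_nonneg_left hmono
      (by positivity : (0 : ℝ) ≤ 3 / 2 * (t + 2 * (s * s) : ℝ))
    have := ih (by omega)
    rw [← add_assoc]
    push_cast at *
    linarith

theorem statement16 (s t : ℕ) (hs : 2 ≤ s) (ht : 2 ≤ t) :
    ∃ δ : ℝ, 0 < δ ∧ ∀ ε : ℝ, 0 < ε → ε < 1/3 → ∃ n0 : ℕ, ∀ n : ℕ, n ≥ n0 →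
      (exBip (⌊((1:ℝ)/3 + ε) * (n : ℝ)⌋₊) (⌊((1:ℝ)/3 + ε) * (n : ℝ)⌋₊) t s : ℝ)
          - (exBip (n/3) (n/3) t s : ℝ) ≤
        10 * ε ^ ((1:ℝ)/2) * δ * (n : ℝ) ^ ((3:ℝ) - 1/((s:ℝ)^2)) := by
  have hK : (0 : ℝ) < t + 2 * (s * s) := by positivity
  refine ⟨t + 2 * (s * s), hK, fun ε hε hε3 => ⟨⌈1 / ε⌉₊ + 1, fun n hn => ?_⟩⟩
  have hεn : 1 ≤ ε * n := by
    have h1 : 1 / ε ≤ n := (Nat.le_ceil _).trans (by exact_mod_cast (by omega : ⌈1 / ε⌉₊ ≤ n))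
    rwa [div_le_iff₀' hε] at h1
  have hn0 : (0 : ℝ) < n := by exact_mod_cast (by omega : 0 < n)
  set N := ⌊((1:ℝ)/3 + ε) * (n : ℝ)⌋₊ with hN
  have hNle : (N : ℝ) ≤ (1 / 3 + ε) * n := Nat.floor_le (by positivity)
  have hMN : n / 3 ≤ N := by
    refine Nat.le_floor ?_
    have : ((n / 3 : ℕ) : ℝ) ≤ n / 3 := Nat.cast_div_le
    linarith
  obtain ⟨k, hk⟩ := Nat.exists_eq_add_of_le hMN
  have hNn : N ≤ n := by
    have : (N : ℝ) ≤ n := by nlinarith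
    exact_mod_cast this
  have hkε : (k : ℝ) ≤ 2 * (ε * n) := by
    have h1 : (N : ℝ) = (n / 3 : ℕ) + k := by exact_mod_cast hk
    have h2 : (n : ℝ) ≤ 3 * (n / 3 : ℕ) + 2 := by
      exact_mod_cast (by omega : n ≤ 3 * (n / 3) + 2)
    linarith
  have hmain := exBip_add_le (n / 3) k t s n (by omega) (by omega) (by omega)
  rw [← hk] at hmain
  have hexp : (n : ℝ) ^ ((3 : ℝ) - 1 / (s : ℝ) ^ 2) =
      n * (n : ℝ) ^ ((2 : ℝ) - 1 / (s : ℝ) ^ 2) := by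
    rw [show (3 : ℝ) - 1 / (s : ℝ) ^ 2 = 1 + (2 - 1 / (s : ℝ) ^ 2) by ring,
      Real.rpow_add hn0, Real.rpow_one]
  have hsqrt : ε ≤ ε ^ ((1:ℝ)/2) := by
    simpa using Real.rpow_le_rpow_of_exponent_ge hε (by linarith) (by norm_num : (1:ℝ)/2 ≤ 1)
  rw [hexp]
  set P := (n : ℝ) ^ ((2 : ℝ) - 1 / (s : ℝ) ^ 2) with hP
  have hP0 : 0 ≤ P := by positivity
  calc _ ≤ k * (3 / 2 * (t + 2 * (s * s) : ℝ) * P) := by linarith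
    _ ≤ 2 * (ε * n) * (3 / 2 * (t + 2 * (s * s) : ℝ) * P) := by gcongr
    _ = 3 * ε * (t + 2 * (s * s)) * (n * P) := by ring
    _ ≤ _ := by gcongr; norm_num
end

section
/- For every η > 0 and all integers m_1, ℓ_2 ≥ 1, there exist C = C(η, m_1, ℓ_2) and n_0 = n_0(η, m_1, ℓ_2) such that the following holds for every 3-graph H on n > n_0 vertices. If A = {a_1, …, a_C} ⊆ V(H) is a set of C vertices such that for each i ≤ C the link graph of a_i restricted to V(H) ∖ A has at least η·n² edges, then there exist two disjoint sets W_1, W_2 ⊆ V(H) ∖ A, each of size m_1, and a set A' ⊆ A of size ℓ_2, such that for every w_1 ∈ W_1, w_2 ∈ W_2 and a ∈ A', the triple {w_1, w_2, a} is a hyperedge of H. -/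
open Finset

open Classical in
/-- A family of `C` sets of density at least `δ` in a finite type contains `l` sets whose
intersection has density at least `ε`, where `C` and `ε > 0` depend only on `δ` and `l`. -/
theorem exists_dense_common_neighbors {δ : ℝ} (hδ : 0 < δ) (l : ℕ) :
    ∃ (C : ℕ) (ε : ℝ), 0 < ε ∧ ∀ {α β : Type} [Fintype β] (N : α → Finset β) (A : Finset α),
      A.card = C → (∀ a ∈ A, δ * (Fintype.card β : ℝ) ≤ (N a).card) →
      ∃ A' ⊆ A, ∃ B : Finset β, A'.card = l ∧ ε * (Fintype.card β : ℝ) ≤ B.card ∧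
        ∀ a ∈ A', B ⊆ N a := by
  obtain ⟨k, hk⟩ := exists_nat_ge (2 * l / δ)
  rw [div_le_iff₀ hδ] at hk
  set C := l + k + 1 with hC
  have hch : (0 : ℝ) < (C.choose l : ℝ) := by
    exact_mod_cast Nat.choose_pos (by omega)
  have hCpos : (0 : ℝ) < C := by positivity
  have hCl : 2 * (l : ℝ) ≤ C * δ := by
    have : (k : ℝ) ≤ C := by exact_mod_cast (by omega : k ≤ C)
    nlinarith
  refine ⟨C, δ / 2 / C.choose l, by positivity, ?_⟩
  intro α β _ N A hA hdeg
  set P : Finset β := Finset.univ.filter (fun b => l ≤ (A.filter (fun a => b ∈ N a)).card) with hP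
  have hdouble : ∑ a ∈ A, (N a).card =
      ∑ b : β, (A.filter (fun a => b ∈ N a)).card := by
    simpa [Finset.bipartiteAbove, Finset.bipartiteBelow] using
      Finset.sum_card_bipartiteAbove_eq_sum_card_bipartiteBelow (s := A) (t := Finset.univ)
        (fun a b => b ∈ N a)
  have hlow : C * (δ * (Fintype.card β : ℝ)) ≤
      ∑ a ∈ A, ((N a).card : ℝ) := by
    rw [← hA, ← nsmul_eq_mul]
    exact Finset.card_nsmul_le_sum _ _ _ hdeg
  have hup : ∑ b : β, (A.filter (fun a => b ∈ N a)).card ≤ P.card * C + Fintype.card β * l := by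
    calc ∑ b : β, (A.filter (fun a => b ∈ N a)).card
        ≤ ∑ b : β, ((if b ∈ P then C else 0) + l) := by
          refine Finset.sum_le_sum fun b _ => ?_
          split_ifs with hb
          · exact le_add_right (hA ▸ Finset.card_filter_le _ _)
          · simp only [hP, Finset.mem_filter, Finset.mem_univ, true_and, not_le] at hb
            omega
      _ = P.card * C + Fintype.card β * l := by
          simp [Finset.sum_add_distrib, Finset.sum_ite_mem]
  have hPcard : δ / 2 * (Fintype.card β : ℝ) ≤ P.card := by
    have h1 : C * (δ * (Fintype.card β : ℝ)) ≤ P.card * C + Fintype.card β * l := by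
      refine hlow.trans ?_
      exact_mod_cast hdouble.le.trans hup
    have h2 : (0 : ℝ) ≤ Fintype.card β := by positivity
    refine le_of_mul_le_mul_left ?_ hCpos
    nlinarith
  have hcover : P ⊆ (A.powersetCard l).biUnion
      (fun S => Finset.univ.filter (fun b => ∀ a ∈ S, b ∈ N a)) := by
    intro b hb
    obtain ⟨S, hS, hSl⟩ := Finset.exists_subset_card_eq (Finset.mem_filter.1 hb).2
    simp only [Finset.mem_biUnion, Finset.mem_powersetCard, Finset.mem_filter, Finset.mem_univ,
      true_and]
    exact ⟨S, ⟨hS.trans (Finset.filter_subset _ _), hSl⟩,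
      fun a ha => (Finset.mem_filter.1 (hS ha)).2⟩
  have hne : (A.powersetCard l).Nonempty := Finset.powersetCard_nonempty.2 (by omega)
  obtain ⟨S, hS, hSε⟩ := Finset.exists_le_of_sum_le (s := A.powersetCard l)
    (f := fun _ => δ / 2 / C.choose l * (Fintype.card β : ℝ))
    (g := fun S => ((Finset.univ.filter (fun b => ∀ a ∈ S, b ∈ N a)).card : ℝ)) hne (by
      rw [Finset.sum_const, Finset.card_powersetCard, hA, nsmul_eq_mul]
      calc (C.choose l : ℝ) * (δ / 2 / C.choose l * (Fintype.card β : ℝ))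
          = δ / 2 * Fintype.card β := by field_simp
        _ ≤ P.card := hPcard
        _ ≤ _ := by exact_mod_cast (Finset.card_le_card hcover).trans Finset.card_biUnion_le)
  obtain ⟨hSA, hSl⟩ := Finset.mem_powersetCard.1 hS
  exact ⟨S, hSA, _, hSl, hSε, fun a ha b hb => (Finset.mem_filter.1 hb).2 a ha⟩

open Classical in
/-- A dense set of ordered pairs on a large enough finite set contains a product of two
sets of size `m`. -/
theorem exists_complete_bipartite_of_dense {c : ℝ} (hc : 0 < c) (m : ℕ) :
    ∃ n0 : ℕ, ∀ n > n0, ∀ Q : Finset (Fin n × Fin n), c * (n : ℝ) ^ 2 ≤ Q.card →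
      ∃ S T : Finset (Fin n), S.card = m ∧ T.card = m ∧ ∀ x ∈ S, ∀ y ∈ T, (x, y) ∈ Q := by
  obtain ⟨C, ε, hε, hcommon⟩ := exists_dense_common_neighbors (half_pos hc) m
  obtain ⟨k₁, hk₁⟩ := exists_nat_ge (C / (c / 2))
  obtain ⟨k₂, hk₂⟩ := exists_nat_ge (m / ε)
  rw [div_le_iff₀ (half_pos hc)] at hk₁
  rw [div_le_iff₀ hε] at hk₂
  refine ⟨k₁ + k₂, fun n hn Q hQ => ?_⟩
  have hnpos : (0 : ℝ) < n := by exact_mod_cast (by omega : 0 < n)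
  have hn₁ : (k₁ : ℝ) ≤ n := by exact_mod_cast (by omega : k₁ ≤ n)
  have hn₂ : (k₂ : ℝ) ≤ n := by exact_mod_cast (by omega : k₂ ≤ n)
  set X : Finset (Fin n) := Finset.univ.filter
    (fun x => c / 2 * (n : ℝ) ≤ (Finset.univ.filter (fun y => (x, y) ∈ Q)).card) with hX
  have hsum : Q.card =
      ∑ x : Fin n, (Finset.univ.filter (fun y => (x, y) ∈ Q)).card := by
    simp_rw [Finset.card_filter]
    rw [← Fintype.sum_prod_type' (f := fun x y => if (x, y) ∈ Q then 1 else 0)]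
    simp
  have hup : ((∑ x : Fin n, (Finset.univ.filter (fun y => (x, y) ∈ Q)).card : ℕ) : ℝ) ≤
      X.card * n + n * (c / 2 * n) := by
    push_cast
    calc ∑ x : Fin n, ((Finset.univ.filter (fun y => (x, y) ∈ Q)).card : ℝ)
        ≤ ∑ x : Fin n, ((if x ∈ X then (n : ℝ) else 0) + c / 2 * n) := by
          refine Finset.sum_le_sum fun x _ => ?_
          split_ifs with hx
          · have : ((Finset.univ.filter (fun y => (x, y) ∈ Q)).card : ℝ) ≤ n := by
              exact_mod_cast (Finset.card_le_univ _).trans_eq (Fintype.card_fin n)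
            nlinarith
          · simp only [hX, Finset.mem_filter, Finset.mem_univ, true_and, not_le] at hx
            linarith
      _ = X.card * n + n * (c / 2 * n) := by
          simp [Finset.sum_add_distrib, Finset.sum_ite_mem]
  have hXcard : C ≤ X.card := by
    rw [hsum] at hQ
    have h1 : c / 2 * n ≤ X.card := by
      refine le_of_mul_le_mul_right ?_ hnpos
      nlinarith
    have h2 : (C : ℝ) ≤ X.card := by nlinarith
    exact_mod_cast h2
  obtain ⟨Y, hYX, hYC⟩ := Finset.exists_subset_card_eq hXcard
  obtain ⟨S, -, B, hSm, hB, hSB⟩ :=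
    hcommon (fun x => Finset.univ.filter (fun y => (x, y) ∈ Q)) Y hYC (fun x hx => by
      rw [Fintype.card_fin]
      exact (Finset.mem_filter.1 (hYX hx)).2)
  rw [Fintype.card_fin] at hB
  have hm : m ≤ B.card := by
    have : (m : ℝ) ≤ B.card := by nlinarith
    exact_mod_cast this
  obtain ⟨T, hT, hTm⟩ := Finset.exists_subset_card_eq hm
  exact ⟨S, T, hSm, hTm, fun x hx y hy => (Finset.mem_filter.1 (hSB x hx (hT hy))).2⟩

/-- The number of two-element subsets of `B` with a property is at most the number of ordered
pairs of elements of `B` enumerating such a subset. -/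
theorem card_filter_powersetCard_two_le {α : Type*} [Fintype α] [DecidableEq α] (B : Finset α)
    (q : Finset α → Prop) [DecidablePred q] :
    ((B.powersetCard 2).filter q).card ≤
      (Finset.univ.filter (fun p : α × α => p.1 ∈ B ∧ p.2 ∈ B ∧ q {p.1, p.2})).card := by
  refine (Finset.card_le_card (t := (Finset.univ.filter
    (fun p : α × α => p.1 ∈ B ∧ p.2 ∈ B ∧ q {p.1, p.2})).image (fun p => {p.1, p.2})) ?_).trans
    Finset.card_image_le
  intro e he
  obtain ⟨he, hqe⟩ := Finset.mem_filter.1 he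
  obtain ⟨heB, he2⟩ := Finset.mem_powersetCard.1 he
  obtain ⟨x, y, -, rfl⟩ := Finset.card_eq_two.1 he2
  exact Finset.mem_image.2 ⟨(x, y), Finset.mem_filter.2
    ⟨Finset.mem_univ _, heB (by simp), heB (by simp), hqe⟩, rfl⟩

theorem statement17 (η : ℝ) (hη : 0 < η) (m1 l2 : ℕ) (hm1 : 1 ≤ m1) (hl2 : 1 ≤ l2) :
    ∃ C n0 : ℕ, ∀ n : ℕ, n > n0 →
    ∀ H : Finset (Finset (Fin n)), (∀ e ∈ H, e.card = 3) →
    ∀ A : Finset (Fin n), A.card = C →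
    (∀ a ∈ A, η * (n : ℝ)^2 ≤
      (((((Finset.univ : Finset (Fin n)) \ A).powersetCard 2).filter
        (fun p => insert a p ∈ H)).card : ℝ)) →
    ∃ W1 W2 : Finset (Fin n),
      W1 ⊆ (Finset.univ : Finset (Fin n)) \ A ∧ W2 ⊆ (Finset.univ : Finset (Fin n)) \ A ∧
      Disjoint W1 W2 ∧ W1.card = m1 ∧ W2.card = m1 ∧
      ∃ A' ⊆ A, A'.card = l2 ∧
        ∀ w1 ∈ W1, ∀ w2 ∈ W2, ∀ a ∈ A', ({w1, w2, a} : Finset (Fin n)) ∈ H := by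
  obtain ⟨C, ε, hε, hcommon⟩ := exists_dense_common_neighbors hη l2
  obtain ⟨n0, hbip⟩ := exists_complete_bipartite_of_dense hε m1
  refine ⟨C, n0, fun n hn H hH A hA hdeg => ?_⟩
  have hcard : (Fintype.card (Fin n × Fin n) : ℝ) = (n : ℝ) ^ 2 := by
    simp [sq]
  obtain ⟨A', hA'A, Q, hA'l, hQ, hQA'⟩ := hcommon
    (fun a : Fin n => Finset.univ.filter (fun p : Fin n × Fin n =>
      p.1 ∈ Finset.univ \ A ∧ p.2 ∈ Finset.univ \ A ∧ insert a {p.1, p.2} ∈ H)) A hA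
    (fun a ha => by
      rw [hcard]
      refine (hdeg a ha).trans ?_
      exact_mod_cast card_filter_powersetCard_two_le (Finset.univ \ A) (fun p => insert a p ∈ H))
  rw [hcard] at hQ
  obtain ⟨W1, W2, hW1, hW2, hWQ⟩ := hbip n hn Q hQ
  have hW : ∀ x ∈ W1, ∀ y ∈ W2, ∀ a ∈ A',
      x ∈ Finset.univ \ A ∧ y ∈ Finset.univ \ A ∧ insert a {x, y} ∈ H :=
    fun x hx y hy a ha => (Finset.mem_filter.1 (hQA' a ha (hWQ x hx y hy))).2
  obtain ⟨a₀, ha₀⟩ : A'.Nonempty := Finset.card_pos.1 (by omega)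
  obtain ⟨x₀, hx₀⟩ : W1.Nonempty := Finset.card_pos.1 (by omega)
  obtain ⟨y₀, hy₀⟩ : W2.Nonempty := Finset.card_pos.1 (by omega)
  refine ⟨W1, W2, fun x hx => (hW x hx y₀ hy₀ a₀ ha₀).1,
    fun y hy => (hW x₀ hx₀ y hy a₀ ha₀).2.1, ?_, hW1, hW2, A', hA'A, hA'l, ?_⟩
  · refine Finset.disjoint_left.2 fun w hw1 hw2 => ?_
    have h3 := hH _ (hW w hw1 w hw2 a₀ ha₀).2.2
    rw [Finset.pair_eq_singleton] at h3
    have := Finset.card_le_two (a := a₀) (b := w)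
    omega
  · intro x hx y hy a ha
    have h := (hW x hx y hy a ha).2.2
    rwa [Finset.insert_comm, Finset.pair_comm a y] at h
end

section
/- For every integer t ≥ 1 there exists n_0 such that for all n ≥ n_0: for every 3-set E of vertices of T_3(n,3) that is not a hyperedge of T_3(n,3), the 3-graph obtained from T_3(n,3) by adding the hyperedge E contains a copy of F_sim(t). -/
open Finset

/-- Three vertices with pairwise distinct residues mod 3 form a hyperedge of `T_3(n,3)`. -/
theorem triple_mem_T3 {n : ℕ} {a b c : Fin n} (hab : (a : ℕ) % 3 ≠ (b : ℕ) % 3)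
    (hac : (a : ℕ) % 3 ≠ (c : ℕ) % 3) (hbc : (b : ℕ) % 3 ≠ (c : ℕ) % 3) :
    ({a, b, c} : Finset (Fin n)) ∈ T3 n := by
  simp only [T3, mem_filter, mem_univ, true_and]
  refine ⟨card_eq_three.2 ⟨a, b, c, by grind, by grind, by grind, rfl⟩, fun i => ?_⟩
  have hi := i.isLt
  have key : (i : ℕ) = (a : ℕ) % 3 ∨ (i : ℕ) = (b : ℕ) % 3 ∨ (i : ℕ) = (c : ℕ) % 3 := by omega
  rw [card_eq_one]
  rcases key with h | h | h
  · exact ⟨a, by ext v; simp only [turanPart, mem_inter, mem_filter, mem_univ, true_and,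
      mem_insert, mem_singleton]; grind⟩
  · exact ⟨b, by ext v; simp only [turanPart, mem_inter, mem_filter, mem_univ, true_and,
      mem_insert, mem_singleton]; grind⟩
  · exact ⟨c, by ext v; simp only [turanPart, mem_inter, mem_filter, mem_univ, true_and,
      mem_insert, mem_singleton]; grind⟩

/-- Any finite index type embeds into `range (card ι + 3)` avoiding three given values. -/
theorem exists_embedding_avoiding_three (ι : Type*) [Fintype ι] (a b c : ℕ) :
    ∃ g : ι ↪ ℕ, ∀ s, g s < Fintype.card ι + 3 ∧ g s ≠ a ∧ g s ≠ b ∧ g s ≠ c := by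
  have hcard : Fintype.card ι ≤
      Fintype.card ↥(range (Fintype.card ι + 3) \ ({a, b, c} : Finset ℕ)) := by
    have h1 := le_card_sdiff ({a, b, c} : Finset ℕ) (range (Fintype.card ι + 3))
    have h2 : ({a, b, c} : Finset ℕ).card ≤ 3 := card_le_three
    rw [card_range] at h1
    rw [Fintype.card_coe]
    omega
  obtain ⟨g⟩ := Function.Embedding.nonempty_of_card_le hcard
  refine ⟨g.trans (Function.Embedding.subtype _), fun s => ?_⟩
  have hs := (g s).2
  simp only [mem_sdiff, mem_range, mem_insert, mem_singleton, not_or] at hs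
  exact hs

/-- Adding to `T_3(n,3)` a triple with two vertices `x`, `y` in a common part creates a copy of
`F_sim(t)` in which `x`, `y`, `z` play the roles of `f_3`, `f_4`, `f_5`. -/
theorem hasCopy_Fsim_of_same_part {n t : ℕ} (hn : 3 * (t + 7) ≤ n) {x y z : Fin n}
    (hxy : x ≠ y) (hxz : x ≠ z) (hyz : y ≠ z) (hpart : (x : ℕ) % 3 = (y : ℕ) % 3) :
    HasCopy (insert {x, y, z} (T3 n)) (Fsim t) := by
  obtain ⟨g, hg⟩ := exists_embedding_avoiding_three (Fin 4 ⊕ Fin t)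
    ((x : ℕ) / 3) ((y : ℕ) / 3) ((z : ℕ) / 3)
  obtain ⟨v, hv⟩ : ∃ v : Fin 4 ⊕ Fin t → ℕ → Fin n,
      ∀ s i, (v s i : ℕ) = 3 * g s + i % 3 :=
    ⟨fun s i => ⟨3 * g s + i % 3, by
      have := (hg s).1
      simp only [Fintype.card_sum, Fintype.card_fin] at this
      omega⟩, fun _ _ => rfl⟩
  have hmod : ∀ s i, (v s i : ℕ) % 3 = i % 3 := fun s i => by rw [hv]; omega
  have hinj : ∀ {s s' i i'}, v s i = v s' i' → s = s' := fun {s s' i i'} h => by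
    have h' := congrArg Fin.val h
    rw [hv, hv] at h'
    exact g.injective (by omega)
  have hx : ∀ s i, v s i ≠ x := fun s i h => (hg s).2.1 (by rw [← h, hv]; omega)
  have hy : ∀ s i, v s i ≠ y := fun s i h => (hg s).2.2.1 (by rw [← h, hv]; omega)
  have hz : ∀ s i, v s i ≠ z := fun s i h => (hg s).2.2.2 (by rw [← h, hv]; omega)
  let f : Fin 7 ⊕ Fin t → Fin n := Sum.elim
    ![v (.inl 0) (x + 1), v (.inl 1) (x + 2), x, y, z, v (.inl 2) (z + 1), v (.inl 3) (z + 2)]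
    (fun j => v (.inr j) z)
  have hf : Function.Injective f := by
    have hne : ∀ {s s' i i'}, s ≠ s' → v s i ≠ v s' i' := fun h h' => h (hinj h')
    refine Function.Injective.sumElim ?_ (fun j j' h => Sum.inr_injective (hinj h)) ?_
    · intro i i'
      fin_cases i <;> fin_cases i' <;>
        first
        | exact fun _ => rfl
        | exact fun h => absurd h (hne (by simp))
        | exact fun h => absurd h (hx _ _)
        | exact fun h => absurd h (hy _ _)
        | exact fun h => absurd h (hz _ _)
        | exact fun h => absurd h.symm (hx _ _)
        | exact fun h => absurd h.symm (hy _ _)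
        | exact fun h => absurd h.symm (hz _ _)
        | exact fun h => absurd h (by assumption)
        | exact fun h => absurd h.symm (by assumption)
    · intro i j
      fin_cases i
      exacts [hne (by simp), hne (by simp), (hx _ _).symm, (hy _ _).symm, (hz _ _).symm,
        hne (by simp), hne (by simp)]
  refine ⟨⟨f, hf⟩, fun e he => ?_⟩
  simp only [Fsim, mem_union, mem_insert, mem_singleton, mem_image, mem_univ, true_and] at he
  rcases he with (rfl | rfl | rfl | rfl) | ⟨j, rfl⟩ <;>
    simp only [image_insert, image_singleton, Function.Embedding.coeFn_mk]
  · exact mem_insert_of_mem (triple_mem_T3 (by simp [f, hmod]; omega) (by simp [f, hmod]; omega)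
      (by simp [f, hmod]; omega))
  · exact mem_insert_of_mem (triple_mem_T3 (by simp [f, hmod]; omega) (by simp [f, hmod]; omega)
      (by simp [f, hmod]; omega))
  · exact mem_insert_self _ _
  · exact mem_insert_of_mem (triple_mem_T3 (by simp [f, hmod]; omega) (by simp [f, hmod]; omega)
      (by simp [f, hmod]; omega))
  · exact mem_insert_of_mem (triple_mem_T3 (by simp [f, hmod]; omega) (by simp [f, hmod]; omega)
      (by simp [f, hmod]; omega))

theorem statement18 (t : ℕ) (ht : 1 ≤ t) :
    ∃ n0 : ℕ, ∀ n : ℕ, n ≥ n0 →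
    ∀ E : Finset (Fin n), E.card = 3 → E ∉ T3 n →
      HasCopy (insert E (T3 n)) (Fsim t) := by
  refine ⟨3 * (t + 7), fun n hn E hE hET => ?_⟩
  obtain ⟨a, b, c, hab, hac, hbc, rfl⟩ := card_eq_three.1 hE
  by_cases h1 : (a : ℕ) % 3 = (b : ℕ) % 3
  · exact hasCopy_Fsim_of_same_part hn hab hac hbc h1
  by_cases h2 : (a : ℕ) % 3 = (c : ℕ) % 3
  · rw [show ({a, b, c} : Finset (Fin n)) = {a, c, b} by rw [pair_comm]]
    exact hasCopy_Fsim_of_same_part hn hac hab hbc.symm h2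
  by_cases h3 : (b : ℕ) % 3 = (c : ℕ) % 3
  · rw [show ({a, b, c} : Finset (Fin n)) = {b, c, a} by rw [insert_comm, pair_comm a c]]
    exact hasCopy_Fsim_of_same_part hn hbc hab.symm hac.symm h3
  exact absurd (triple_mem_T3 h1 h2 h3) hET
end
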